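/- Let n ≥ 2, let D be a domain in ℝⁿ, and let x₀ ∈ D. Then for every P > 0 and every neighborhood U of x₀ there is a neighborhood V ⊂ U of x₀ such that M(Γ(E, F, D)) > P for any continua E, F ⊂ D each of which intersects both ∂U and ∂V. -/

import Mathlib

open MeasureTheory Metric Set Filter Topology
open scoped ENNReal NNReal

noncomputable section
open scoped Classical

/-- The (clamped) total-variation function of `γ` on `[a, b]`. -/
def varFun (n : ℕ) (γ : ℝ → EuclideanSpace ℝ (Fin n)) (a b t : ℝ) : ℝ :=
  (eVariationOn γ (Set.Icc a (max a (min t b)))).toReal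

/-- The arc-length (Lebesgue–Stieltjes) integral `∫_γ ρ ds` of a Borel function
`ρ : ℝⁿ → [0,∞]` along the path `γ : [a, b] → ℝⁿ`, defined via the Lebesgue–Stieltjes
measure associated to the arc-length (variation) function of `γ`.  It is `∞` when `γ`
is not rectifiable. -/
def arcIntegral (n : ℕ) (ρ : EuclideanSpace ℝ (Fin n) → ℝ≥0∞)
    (γ : ℝ → EuclideanSpace ℝ (Fin n)) (a b : ℝ) : ℝ≥0∞ :=
  if h : BoundedVariationOn γ (Set.Icc a b) ∧ Monotone (varFun n γ a b) then
    ∫⁻ t in Set.Icc a b, ρ (γ t) ∂h.2.stieltjesFunction.measure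
  else ∞

/-- A (continuous) path in `ℝⁿ` defined on a compact interval `[a, b]`. -/
structure PathOn (n : ℕ) where
  a : ℝ
  b : ℝ
  hab : a ≤ b
  toFun : ℝ → EuclideanSpace ℝ (Fin n)
  cont : ContinuousOn toFun (Set.Icc a b)

/-- A Borel function `ρ : ℝⁿ → [0,∞]` is admissible for a family `Γ` of paths if
`∫_γ ρ ds ≥ 1` for every (locally rectifiable) path `γ ∈ Γ`. -/
def IsAdmissibleFor (n : ℕ) (ρ : EuclideanSpace ℝ (Fin n) → ℝ≥0∞)
    (Γ : Set (PathOn n)) : Prop :=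
  Measurable ρ ∧ ∀ γ ∈ Γ, 1 ≤ arcIntegral n ρ γ.toFun γ.a γ.b

/-- The (conformal) modulus `M(Γ)` of a family of paths in `ℝⁿ`. -/
def modulus (n : ℕ) (Γ : Set (PathOn n)) : ℝ≥0∞ :=
  ⨅ (ρ : EuclideanSpace ℝ (Fin n) → ℝ≥0∞) (_ : IsAdmissibleFor n ρ Γ),
    ∫⁻ x, ρ x ^ n

/-- The spherical annulus `A(y₀, r₁, r₂) = {y : r₁ < |y − y₀| < r₂}`. -/
def annulus (n : ℕ) (y₀ : EuclideanSpace ℝ (Fin n)) (r₁ r₂ : ℝ) :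
    Set (EuclideanSpace ℝ (Fin n)) :=
  {y | r₁ < dist y y₀ ∧ dist y y₀ < r₂}

/-- `Γ(E, F, G)`: the family of all paths `γ : [a,b] → ℝⁿ` with `γ(a) ∈ E`,
`γ(b) ∈ F` and `γ(t) ∈ G` for `t ∈ (a, b)`. -/
def pathsBetween (n : ℕ) (E F G : Set (EuclideanSpace ℝ (Fin n))) : Set (PathOn n) :=
  {γ | γ.toFun γ.a ∈ E ∧ γ.toFun γ.b ∈ F ∧ ∀ t ∈ Set.Ioo γ.a γ.b, γ.toFun t ∈ G}

/-- `Γ_f(y₀, r₁, r₂)`: the family of all paths `γ` in `D` such that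
`f ∘ γ ∈ Γ(S(y₀,r₁), S(y₀,r₂), A(y₀,r₁,r₂))`. -/
def liftedFamily (n : ℕ) (D : Set (EuclideanSpace ℝ (Fin n)))
    (f : EuclideanSpace ℝ (Fin n) → EuclideanSpace ℝ (Fin n))
    (y₀ : EuclideanSpace ℝ (Fin n)) (r₁ r₂ : ℝ) : Set (PathOn n) :=
  {γ | (∀ t ∈ Set.Icc γ.a γ.b, γ.toFun t ∈ D) ∧
    f (γ.toFun γ.a) ∈ Metric.sphere y₀ r₁ ∧ f (γ.toFun γ.b) ∈ Metric.sphere y₀ r₂ ∧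
    ∀ t ∈ Set.Ioo γ.a γ.b, f (γ.toFun t) ∈ annulus n y₀ r₁ r₂}

/-- `f` satisfies the inverse Poletsky inequality at `y₀` with majorant `Q`. -/
def InvPoletsky (n : ℕ) (D : Set (EuclideanSpace ℝ (Fin n)))
    (f : EuclideanSpace ℝ (Fin n) → EuclideanSpace ℝ (Fin n))
    (Q : EuclideanSpace ℝ (Fin n) → ℝ≥0∞) (y₀ : EuclideanSpace ℝ (Fin n)) : Prop :=
  ∃ r₀ > (0 : ℝ), ∀ r₁ r₂ : ℝ, 0 < r₁ → r₁ < r₂ → r₂ < r₀ →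
    ∀ η : ℝ → ℝ≥0∞, Measurable η → 1 ≤ ∫⁻ r in Set.Ioo r₁ r₂, η r →
      modulus n (liftedFamily n D f y₀ r₁ r₂) ≤
        ∫⁻ y in (f '' D) ∩ annulus n y₀ r₁ r₂, Q y * η (dist y y₀) ^ n

/-- `f` is discrete on `D`: every fiber has no accumulation point in `D`. -/
def IsDiscreteOn (n : ℕ) (D : Set (EuclideanSpace ℝ (Fin n)))
    (f : EuclideanSpace ℝ (Fin n) → EuclideanSpace ℝ (Fin n)) : Prop :=
  ∀ y, ∀ x ∈ D, ¬ AccPt x (Filter.principal {z | z ∈ D ∧ f z = y})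

/-- `f` is open on `D`: the image of every open subset of `D` is open. -/
def IsOpenOn (n : ℕ) (D : Set (EuclideanSpace ℝ (Fin n)))
    (f : EuclideanSpace ℝ (Fin n) → EuclideanSpace ℝ (Fin n)) : Prop :=
  ∀ U : Set (EuclideanSpace ℝ (Fin n)), IsOpen U → U ⊆ D → IsOpen (f '' U)

/-- The chordal (spherical) metric `h(x,y) = |x−y|/(√(1+|x|²)·√(1+|y|²))`. -/
def chordal (n : ℕ) (x y : EuclideanSpace ℝ (Fin n)) : ℝ :=
  dist x y / (Real.sqrt (1 + ‖x‖ ^ 2) * Real.sqrt (1 + ‖y‖ ^ 2))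

/-- A family of mappings of `D` is equicontinuous at `x₀ ∈ D` w.r.t. the chordal
metric on the target. -/
def EquicontinuousAtPt (n : ℕ) (D : Set (EuclideanSpace ℝ (Fin n)))
    (𝓕 : Set (EuclideanSpace ℝ (Fin n) → EuclideanSpace ℝ (Fin n)))
    (x₀ : EuclideanSpace ℝ (Fin n)) : Prop :=
  ∀ ε > (0 : ℝ), ∃ δ > (0 : ℝ), ∀ f ∈ 𝓕, ∀ x ∈ D, dist x x₀ < δ →
    chordal n (f x) (f x₀) < ε


/-- Integration in polar coordinates for nonnegative functions. -/
theorem lintegral_polar {E : Type*} [NormedAddCommGroup E] [NormedSpace ℝ E]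
    [FiniteDimensional ℝ E] [Nontrivial E] [MeasurableSpace E] [BorelSpace E] (μ : Measure E)
    [μ.IsAddHaarMeasure] {f : E → ℝ≥0∞} (hf : Measurable f) :
    ∫⁻ x, f x ∂μ = ∫⁻ t in Ioi (0 : ℝ), ENNReal.ofReal (t ^ (Module.finrank ℝ E - 1)) *
      ∫⁻ ω : sphere (0 : E) 1, f (t • (ω : E)) ∂μ.toSphere := by
  have hmp := μ.measurePreserving_homeomorphUnitSphereProd
  have hmeas : Measurable
      (fun p : sphere (0 : E) 1 × Ioi (0 : ℝ) => f ((p.2 : ℝ) • (p.1 : E))) :=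
    hf.comp (g := f) (f := fun p : sphere (0 : E) 1 × Ioi (0 : ℝ) => (p.2 : ℝ) • (p.1 : E))
      (by fun_prop)
  have h1 : ∫⁻ x, f x ∂μ = ∫⁻ x : ({0}ᶜ : Set E), f x ∂(μ.comap Subtype.val) := by
    rw [lintegral_subtype_comap (measurableSet_singleton _).compl, restrict_compl_singleton]
  have h2 : ∀ x : ({0}ᶜ : Set E), f x =
      (fun p : sphere (0 : E) 1 × Ioi (0 : ℝ) => f ((p.2 : ℝ) • (p.1 : E)))
        (homeomorphUnitSphereProd E x) := fun x => by
    congr 1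
    have hx : ‖(x : E)‖ ≠ 0 := norm_ne_zero_iff.2 x.2
    simp [smul_smul, hx]
  rw [h1, lintegral_congr h2, hmp.lintegral_comp hmeas, lintegral_prod_symm' _ hmeas,
    Measure.volumeIoiPow, lintegral_withDensity_eq_lintegral_mul _ (by fun_prop)
      hmeas.lintegral_prod_left']
  simp only [Pi.mul_apply]
  rw [lintegral_subtype_comap measurableSet_Ioi (fun t : ℝ => ENNReal.ofReal (t ^ (Module.finrank ℝ E - 1)) *
    ∫⁻ ω : sphere (0 : E) 1, f (t • (ω : E)) ∂μ.toSphere)]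

/-- A Stieltjes function that is `L`-Lipschitz has measure at most `L` times Lebesgue measure. -/
theorem StieltjesFunction.measure_le_of_sub_le (F : StieltjesFunction ℝ) (L : ℝ≥0)
    (h : ∀ c d, c ≤ d → F d - F c ≤ L * (d - c)) : F.measure ≤ L • (volume : Measure ℝ) := by
  let G : StieltjesFunction ℝ :=
    { toFun := fun x => L * x - F x
      mono' := fun c d hcd => by
        have := h c d hcd
        dsimp only
        linarith
      right_continuous' := fun x =>
        (continuous_const.mul continuous_id).continuousWithinAt.sub (F.right_continuous x) }
  have hFG : F + G = L • StieltjesFunction.id := by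
    ext x
    change F x + (L * x - F x) = L * x
    ring
  calc F.measure ≤ F.measure + G.measure := Measure.le_add_right le_rfl
    _ = L • volume := by
      rw [← StieltjesFunction.measure_add, hFG, StieltjesFunction.measure_smul,
        Real.volume_eq_stieltjes_id]

/-- Along an `L`-Lipschitz path the arc-length integral is at most `L` times the integral
in the parameter. -/
theorem arcIntegral_le_of_lipschitzOnWith {n : ℕ} (ρ : EuclideanSpace ℝ (Fin n) → ℝ≥0∞)
    {γ : ℝ → EuclideanSpace ℝ (Fin n)} {a b : ℝ} (hab : a ≤ b) {L : ℝ≥0}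
    (hγ : LipschitzOnWith L γ (Icc a b)) :
    arcIntegral n ρ γ a b ≤ L * ∫⁻ t in Icc a b, ρ (γ t) := by
  have hvar : ∀ c d, a ≤ c → c ≤ d → d ≤ b →
      eVariationOn γ (Icc c d) ≤ ENNReal.ofReal (L * (d - c)) := by
    intro c d hac hcd hdb
    have h1 := (hγ.mono (Icc_subset_Icc hac hdb)).comp_eVariationOn_le (mapsTo_id (Icc c d))
    have h2 := (monotoneOn_id (s := Icc c d)).eVariationOn_eq
      (left_mem_Icc.2 hcd) (right_mem_Icc.2 hcd)
    rw [inter_self] at h2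
    rw [ENNReal.ofReal_mul L.coe_nonneg, ENNReal.ofReal_coe_nnreal]
    exact h1.trans_eq (by rw [h2]; rfl)
  have hbv : ∀ c d, a ≤ c → c ≤ d → d ≤ b → eVariationOn γ (Icc c d) ≠ ∞ :=
    fun c d hac hcd hdb => ne_top_of_le_ne_top ENNReal.ofReal_ne_top (hvar c d hac hcd hdb)
  have hdiff : ∀ c d, c ≤ d → 0 ≤ varFun n γ a b d - varFun n γ a b c ∧
      varFun n γ a b d - varFun n γ a b c ≤ L * (d - c) := by
    intro c d hcd
    have hac : a ≤ max a (min c b) := le_max_left _ _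
    have hcd' : max a (min c b) ≤ max a (min d b) := by gcongr
    have hdb : max a (min d b) ≤ b := max_le hab (min_le_right _ _)
    have hlen : max a (min d b) - max a (min c b) ≤ d - c := by grind
    have hadd := eVariationOn.Icc_add_Icc γ (s := univ) hac hcd' (mem_univ _)
    simp only [univ_inter] at hadd
    have hadd' := congrArg ENNReal.toReal hadd
    rw [ENNReal.toReal_add (hbv _ _ le_rfl hac (hcd'.trans hdb)) (hbv _ _ hac hcd' hdb)] at hadd'
    have hle := ENNReal.toReal_mono ENNReal.ofReal_ne_top (hvar _ _ hac hcd' hdb)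
    rw [ENNReal.toReal_ofReal (mul_nonneg L.coe_nonneg (sub_nonneg.2 hcd'))] at hle
    have h0 : 0 ≤ (eVariationOn γ (Icc (max a (min c b)) (max a (min d b)))).toReal :=
      ENNReal.toReal_nonneg
    have hmul : L * (max a (min d b) - max a (min c b)) ≤ L * (d - c) := by gcongr
    simp only [varFun]
    constructor <;> linarith
  have hmono : Monotone (varFun n γ a b) := fun c d hcd => sub_nonneg.1 (hdiff c d hcd).1
  have hlip : LipschitzWith L (varFun n γ a b) := by
    refine LipschitzWith.of_dist_le_mul fun c d => ?_
    wlog hcd : c ≤ d generalizing c d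
    · rw [dist_comm, dist_comm c d]
      exact this d c (le_of_not_ge hcd)
    rw [dist_comm, dist_comm c d, Real.dist_eq, Real.dist_eq, abs_of_nonneg (hdiff c d hcd).1,
      abs_of_nonneg (sub_nonneg.2 hcd)]
    exact (hdiff c d hcd).2
  have hbv' : BoundedVariationOn γ (Icc a b) := hbv a b le_rfl hab le_rfl
  rw [arcIntegral, dif_pos ⟨hbv', hmono⟩]
  have hle : hmono.stieltjesFunction.measure ≤ L • (volume : Measure ℝ) := by
    refine StieltjesFunction.measure_le_of_sub_le _ L fun c d hcd => ?_
    rw [hmono.stieltjesFunction_eq, hmono.stieltjesFunction_eq,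
      hlip.continuous.continuousWithinAt.rightLim_eq,
      hlip.continuous.continuousWithinAt.rightLim_eq]
    exact (hdiff c d hcd).2
  calc _ ≤ ∫⁻ t in Icc a b, ρ (γ t) ∂(L • (volume : Measure ℝ)) :=
        lintegral_mono' (Measure.restrict_mono subset_rfl hle) le_rfl
    _ = _ := by
      rw [Measure.restrict_smul, lintegral_smul_measure]
      rfl

/-- A `0`-homogeneous function integrates over the shell `|‖w‖ - 1| ≤ 3 d` to at most
`6 · 4 ^ (n - 1) · d` times its integral over the unit sphere. -/
theorem lintegral_shell_le {n : ℕ} (hn : n ≠ 0) {h : EuclideanSpace ℝ (Fin n) → ℝ≥0∞}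
    (hm : Measurable h) (hh : ∀ r : ℝ, 0 < r → ∀ w, h (r • w) = h w) {d : ℝ}
    (hd1 : d ≤ 1) :
    ∫⁻ w in {w | |‖w‖ - 1| ≤ 3 * d}, h w ≤ ENNReal.ofReal (6 * 4 ^ (n - 1) * d) *
      ∫⁻ ω : sphere (0 : EuclideanSpace ℝ (Fin n)) 1, h ω
        ∂(volume : Measure (EuclideanSpace ℝ (Fin n))).toSphere := by
  have hS : MeasurableSet {w : EuclideanSpace ℝ (Fin n) | |‖w‖ - 1| ≤ 3 * d} :=
    measurableSet_le (by fun_prop) (by fun_prop)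
  have : Nonempty (Fin n) := ⟨⟨0, Nat.pos_of_ne_zero hn⟩⟩
  rw [← lintegral_indicator hS, lintegral_polar volume (hm.indicator hS),
    finrank_euclideanSpace_fin]
  set I := ∫⁻ ω : sphere (0 : EuclideanSpace ℝ (Fin n)) 1, h ω
        ∂(volume : Measure (EuclideanSpace ℝ (Fin n))).toSphere with hI
  have key : ∀ t ∈ Ioi (0 : ℝ), ENNReal.ofReal (t ^ (n - 1)) *
      ∫⁻ ω : sphere (0 : EuclideanSpace ℝ (Fin n)) 1,
        {w : EuclideanSpace ℝ (Fin n) | |‖w‖ - 1| ≤ 3 * d}.indicator h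
          (t • (ω : EuclideanSpace ℝ (Fin n)))
        ∂(volume : Measure (EuclideanSpace ℝ (Fin n))).toSphere ≤
      (Icc (1 - 3 * d) (1 + 3 * d)).indicator
        (fun _ => ENNReal.ofReal (4 ^ (n - 1)) * I) t := by
    intro t (ht : 0 < t)
    have hnorm : ∀ ω : sphere (0 : EuclideanSpace ℝ (Fin n)) 1,
        ‖t • (ω : EuclideanSpace ℝ (Fin n))‖ = t := fun ω => by
      rw [norm_smul, norm_eq_of_mem_sphere, mul_one, Real.norm_of_nonneg ht.le]
    by_cases hmem : t ∈ Icc (1 - 3 * d) (1 + 3 * d)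
    · rw [indicator_of_mem hmem]
      gcongr
      · linarith [hmem.2]
      · refine lintegral_mono fun ω => ?_
        exact (indicator_le_self _ _ _).trans (hh t ht _).le
    · rw [indicator_of_notMem hmem]
      have hz : ∀ ω : sphere (0 : EuclideanSpace ℝ (Fin n)) 1,
          {w : EuclideanSpace ℝ (Fin n) | |‖w‖ - 1| ≤ 3 * d}.indicator h
            (t • (ω : EuclideanSpace ℝ (Fin n))) = 0 := fun ω => by
        refine indicator_of_notMem (fun hω => hmem ?_) _
        rw [mem_ofPred_eq, hnorm, abs_le] at hω
        constructor <;> linarith [hω.1, hω.2]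
      simp [hz]
  calc _ ≤ ∫⁻ t in Ioi (0 : ℝ), (Icc (1 - 3 * d) (1 + 3 * d)).indicator
        (fun _ => ENNReal.ofReal (4 ^ (n - 1)) * I) t := setLIntegral_mono' measurableSet_Ioi key
    _ ≤ ∫⁻ t, (Icc (1 - 3 * d) (1 + 3 * d)).indicator
        (fun _ => ENNReal.ofReal (4 ^ (n - 1)) * I) t :=
        setLIntegral_le_lintegral _ _
    _ = ENNReal.ofReal (6 * 4 ^ (n - 1) * d) * I := by
      rw [lintegral_indicator measurableSet_Icc, setLIntegral_const, Real.volume_Icc, mul_right_comm,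
        ← ENNReal.ofReal_mul (by positivity)]
      congr 2
      ring

/-- Change of variables `v ↦ (1 - d) x + d v`, for a function that is `0`-homogeneous. -/
theorem lintegral_ball_lineMap_le {n : ℕ} (hn : n ≠ 0) {h : EuclideanSpace ℝ (Fin n) → ℝ≥0∞}
    (hm : Measurable h) (hh : ∀ r : ℝ, 0 < r → ∀ w, h (r • w) = h w)
    {x e : EuclideanSpace ℝ (Fin n)} (hx : ‖x‖ = 1) (he : ‖e‖ = 1) {d : ℝ} (hd : 0 < d)
    (hd1 : d ≤ 1) :
    ∫⁻ v in ball e (1 / 4), h ((1 - d) • x + d • v) ≤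
      ENNReal.ofReal ((d ^ n)⁻¹ * (6 * 4 ^ (n - 1) * d)) *
      ∫⁻ ω : sphere (0 : EuclideanSpace ℝ (Fin n)) 1, h ω
        ∂(volume : Measure (EuclideanSpace ℝ (Fin n))).toSphere := by
  have hS : MeasurableSet {w : EuclideanSpace ℝ (Fin n) | |‖w‖ - 1| ≤ 3 * d} :=
    measurableSet_le (by fun_prop) (by fun_prop)
  set S := {w : EuclideanSpace ℝ (Fin n) | |‖w‖ - 1| ≤ 3 * d}
  have hsub : ∀ v ∈ ball e (1 / 4), h ((1 - d) • x + d • v) =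
      S.indicator h ((1 - d) • x + d • v) := by
    intro v hv
    refine (indicator_of_mem ?_ _).symm
    have hvx : ‖v - x‖ ≤ 3 := by
      have h1 : ‖v - e‖ < 1 / 4 := mem_ball_iff_norm.1 hv
      calc ‖v - x‖ = ‖(v - e) + e - x‖ := by congr 1; abel
        _ ≤ ‖v - e‖ + ‖e‖ + ‖x‖ := (norm_sub_le _ _).trans (by gcongr; exact norm_add_le _ _)
        _ ≤ 3 := by rw [he, hx]; linarith
    calc |‖(1 - d) • x + d • v‖ - 1| = |‖(1 - d) • x + d • v‖ - ‖x‖| := by rw [hx]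
      _ ≤ ‖(1 - d) • x + d • v - x‖ := abs_norm_sub_norm_le _ _
      _ = ‖d • (v - x)‖ := by congr 1; module
      _ = d * ‖v - x‖ := by rw [norm_smul, Real.norm_of_nonneg hd.le]
      _ ≤ 3 * d := by nlinarith
  have hmap := Measure.map_addHaar_smul (volume : Measure (EuclideanSpace ℝ (Fin n))) hd.ne'
  have hSm : Measurable fun w => S.indicator h ((1 - d) • x + w) :=
    (hm.indicator hS).comp (measurable_const_add _)
  calc ∫⁻ v in ball e (1 / 4), h ((1 - d) • x + d • v)
      = ∫⁻ v in ball e (1 / 4), S.indicator h ((1 - d) • x + d • v) :=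
        setLIntegral_congr_fun measurableSet_ball hsub
    _ ≤ ∫⁻ v, S.indicator h ((1 - d) • x + d • v) := setLIntegral_le_lintegral _ _
    _ = ∫⁻ w, S.indicator h ((1 - d) • x + w) ∂(Measure.map (d • ·) volume) :=
        (lintegral_map hSm (measurable_const_smul d)).symm
    _ = ENNReal.ofReal (d ^ n)⁻¹ * ∫⁻ w in S, h w := by
        rw [hmap, lintegral_smul_measure, lintegral_add_left_eq_self, lintegral_indicator hS,
          finrank_euclideanSpace_fin, abs_of_nonneg (by positivity), smul_eq_mul]
    _ ≤ _ := by
        rw [ENNReal.ofReal_mul (by positivity), mul_assoc]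
        gcongr
        exact lintegral_shell_le hn hm hh hd1

/-- A weighted Young inequality. -/
theorem ENNReal.le_ofReal_pow_mul_pow_add {n : ℕ} (hn : n ≠ 0) (a : ℝ≥0∞) {l : ℝ} (hl : 0 < l) :
    a ≤ ENNReal.ofReal (l ^ (n - 1)) * a ^ n + ENNReal.ofReal l⁻¹ := by
  obtain ⟨m, rfl⟩ := Nat.exists_eq_succ_of_ne_zero hn
  rcases le_total a (ENNReal.ofReal l⁻¹) with h | h
  · exact h.trans le_add_self
  · refine le_add_right ?_
    have h1 : 1 ≤ ENNReal.ofReal l * a := by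
      calc 1 = ENNReal.ofReal l * ENNReal.ofReal l⁻¹ := by
            rw [← ENNReal.ofReal_mul hl.le, mul_inv_cancel₀ hl.ne', ENNReal.ofReal_one]
        _ ≤ _ := by gcongr
    calc a = 1 ^ m * a := by simp
      _ ≤ (ENNReal.ofReal l * a) ^ m * a := by gcongr
      _ = _ := by
        rw [ENNReal.ofReal_pow hl.le, mul_pow, pow_succ, mul_assoc]
        rfl

/-- The average of a `0`-homogeneous function along `v ↦ (1 - d) x + d v` is controlled by an
integrable power of `d`, with a free parameter `κ` to be optimized. -/
theorem lintegral_ball_lineMap_le_rpow {n : ℕ} (hn : n ≠ 0)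
    {h : EuclideanSpace ℝ (Fin n) → ℝ≥0∞}
    (hm : Measurable h) (hh : ∀ r : ℝ, 0 < r → ∀ w, h (r • w) = h w)
    {x e : EuclideanSpace ℝ (Fin n)} (hx : ‖x‖ = 1) (he : ‖e‖ = 1) {d : ℝ} (hd : 0 < d)
    (hd1 : d ≤ 1) {κ : ℝ} (hκ : 0 < κ) :
    ∫⁻ v in ball e (1 / 4), h ((1 - d) • x + d • v) ≤
      (ENNReal.ofReal (κ ^ (n - 1) * (6 * 4 ^ (n - 1))) *
        ∫⁻ ω : sphere (0 : EuclideanSpace ℝ (Fin n)) 1, h ω ^ n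
          ∂(volume : Measure (EuclideanSpace ℝ (Fin n))).toSphere +
        ENNReal.ofReal κ⁻¹ * volume (ball (0 : EuclideanSpace ℝ (Fin n)) (1 / 4))) *
      ENNReal.ofReal (d ^ (-(1 - 1 / n : ℝ))) := by
  have hn' : (n : ℝ) ≠ 0 := Nat.cast_ne_zero.2 hn
  set β : ℝ := 1 - 1 / n with hβ
  have hdβ : 0 < d ^ β := Real.rpow_pos_of_pos hd _
  have hl : 0 < κ * d ^ β := by positivity
  have hexp : (κ * d ^ β) ^ (n - 1) * ((d ^ n)⁻¹ * (6 * 4 ^ (n - 1) * d)) =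
      κ ^ (n - 1) * (6 * 4 ^ (n - 1)) * d ^ (-β) := by
    have h1 : (d ^ β) ^ (n - 1) * ((d ^ n)⁻¹ * d) = d ^ (-β) := by
      rw [← Real.rpow_natCast (d ^ β), ← Real.rpow_mul hd.le, ← Real.rpow_natCast d n,
        ← Real.rpow_neg hd.le, ← Real.rpow_add_one hd.ne', ← Real.rpow_add hd]
      congr 1
      rw [Nat.cast_sub (Nat.one_le_iff_ne_zero.2 hn), hβ]
      field_simp
      push_cast
      ring
    rw [← h1, mul_pow]
    ring
  have hm' : Measurable fun v => h ((1 - d) • x + d • v) := hm.comp (by fun_prop)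
  calc _ ≤ ∫⁻ v in ball e (1 / 4), (ENNReal.ofReal ((κ * d ^ β) ^ (n - 1)) *
        h ((1 - d) • x + d • v) ^ n + ENNReal.ofReal (κ * d ^ β)⁻¹) :=
        lintegral_mono fun v => ENNReal.le_ofReal_pow_mul_pow_add hn _ hl
    _ = ENNReal.ofReal ((κ * d ^ β) ^ (n - 1)) *
        (∫⁻ v in ball e (1 / 4), h ((1 - d) • x + d • v) ^ n) +
        ENNReal.ofReal (κ * d ^ β)⁻¹ *
          volume (ball (0 : EuclideanSpace ℝ (Fin n)) (1 / 4)) := by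
        rw [lintegral_add_right _ measurable_const, lintegral_const_mul _ (hm'.pow_const n),
          setLIntegral_const, Measure.addHaar_ball_center]
    _ ≤ ENNReal.ofReal ((κ * d ^ β) ^ (n - 1)) *
        (ENNReal.ofReal ((d ^ n)⁻¹ * (6 * 4 ^ (n - 1) * d)) *
          ∫⁻ ω : sphere (0 : EuclideanSpace ℝ (Fin n)) 1, h ω ^ n
            ∂(volume : Measure (EuclideanSpace ℝ (Fin n))).toSphere) +
        ENNReal.ofReal (κ * d ^ β)⁻¹ *
          volume (ball (0 : EuclideanSpace ℝ (Fin n)) (1 / 4)) := by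
        gcongr
        exact lintegral_ball_lineMap_le hn (hm.pow_const n) (fun r hr w => by rw [hh r hr])
          hx he hd hd1
    _ = _ := by
        rw [← mul_assoc, ← ENNReal.ofReal_mul (by positivity), hexp, add_mul, mul_inv,
          ← Real.rpow_neg hd.le, ENNReal.ofReal_mul (by positivity),
          ENNReal.ofReal_mul (p := κ⁻¹) (by positivity)]
        ring

theorem lintegral_one_sub_abs_rpow_lt_top {β : ℝ} (hβ : β < 1) :
    ∫⁻ s in Ioo (-1 : ℝ) 1, ENNReal.ofReal ((1 - |s|) ^ (-β)) < ∞ := by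
  have hint : IntervalIntegrable (fun s : ℝ => s ^ (-β)) volume 0 1 :=
    intervalIntegral.intervalIntegrable_rpow' (by linarith)
  have h1 : IntegrableOn (fun s : ℝ => (1 - |s|) ^ (-β)) (Ioc (-1) 0) := by
    have := (hint.comp_add_right 1)
    rw [intervalIntegrable_iff_integrableOn_Ioc_of_le (by norm_num)] at this
    norm_num at this
    refine this.congr_fun (fun s hs => ?_) measurableSet_Ioc
    simp only [abs_of_nonpos hs.2]
    congr 1
    ring
  have h2 : IntegrableOn (fun s : ℝ => (1 - |s|) ^ (-β)) (Ioc 0 1) := by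
    have := (hint.comp_sub_left 1).symm
    norm_num at this
    rw [intervalIntegrable_iff_integrableOn_Ioc_of_le (by norm_num)] at this
    refine this.congr_fun (fun s hs => ?_) measurableSet_Ioc
    simp only [abs_of_pos hs.1]
  have h3 := h1.union h2
  rw [Ioc_union_Ioc_eq_Ioc (by norm_num) (by norm_num)] at h3
  have h4 := h3.mono_set Ioo_subset_Ioc_self
  refine lt_of_le_of_lt (lintegral_mono fun s => ?_) h4.2
  exact Real.ofReal_le_enorm _

theorem norm_inv_norm_smul_sub_le {E : Type*} [NormedAddCommGroup E] [NormedSpace ℝ E] {a b : E}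
    (ha : a ≠ 0) (hb : b ≠ 0) : ‖‖a‖⁻¹ • a - ‖b‖⁻¹ • b‖ ≤ 2 * ‖a‖⁻¹ * ‖a - b‖ := by
  have ha' := norm_pos_iff.2 ha
  have hb' := norm_pos_iff.2 hb
  have h1 : (‖a‖⁻¹ - ‖b‖⁻¹) * ‖b‖ = ‖a‖⁻¹ * (‖b‖ - ‖a‖) := by field_simp
  calc ‖‖a‖⁻¹ • a - ‖b‖⁻¹ • b‖ = ‖‖a‖⁻¹ • (a - b) + (‖a‖⁻¹ - ‖b‖⁻¹) • b‖ := by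
        congr 1
        module
    _ ≤ ‖‖a‖⁻¹ • (a - b)‖ + ‖(‖a‖⁻¹ - ‖b‖⁻¹) • b‖ := norm_add_le _ _
    _ = ‖a‖⁻¹ * ‖a - b‖ + ‖a‖⁻¹ * |‖b‖ - ‖a‖| := by
        rw [norm_smul, norm_smul, Real.norm_of_nonneg (inv_nonneg.2 ha'.le), Real.norm_eq_abs,
          ← abs_of_pos hb', ← abs_mul, abs_of_pos hb', h1, abs_mul,
          abs_of_pos (inv_pos.2 ha')]
    _ ≤ ‖a‖⁻¹ * ‖a - b‖ + ‖a‖⁻¹ * ‖a - b‖ := by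
        gcongr
        rw [norm_sub_rev]
        exact abs_norm_sub_norm_le _ _
    _ = _ := by ring

/-- The broken line through `x`, `v`, `y`, parametrized by `[-1, 1]`. -/
def brokenLine {E : Type*} [AddCommGroup E] [Module ℝ E] (x v y : E) (s : ℝ) : E :=
  max (-s) 0 • x + (1 - |s|) • v + max s 0 • y

section brokenLine

variable {E : Type*} [NormedAddCommGroup E] [NormedSpace ℝ E] {x v y : E}

theorem brokenLine_of_nonpos {s : ℝ} (hs : s ≤ 0) :
    brokenLine x v y s = (1 - (1 - |s|)) • x + (1 - |s|) • v := by
  simp [brokenLine, max_eq_left (neg_nonneg.2 hs), max_eq_right hs, abs_of_nonpos hs]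

theorem brokenLine_of_nonneg {s : ℝ} (hs : 0 ≤ s) :
    brokenLine x v y s = (1 - (1 - |s|)) • y + (1 - |s|) • v := by
  simp [brokenLine, max_eq_right (neg_nonpos.2 hs), max_eq_left hs, abs_of_nonneg hs, add_comm]

theorem norm_brokenLine_sub_le (hx : ‖x‖ ≤ 1) (hv : ‖v‖ ≤ 2) (hy : ‖y‖ ≤ 1) (s s' : ℝ) :
    ‖brokenLine x v y s - brokenLine x v y s'‖ ≤ 4 * |s - s'| := by
  have h1 : |max (-s) 0 - max (-s') 0| ≤ |s - s'| :=
    (abs_max_sub_max_le_abs _ _ _).trans_eq (by rw [← abs_neg]; congr 1; ring)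
  have h2 : |(1 - |s|) - (1 - |s'|)| ≤ |s - s'| := by
    rw [sub_sub_sub_cancel_left, abs_sub_comm s s']
    exact abs_abs_sub_abs_le _ _
  have h3 : |max s 0 - max s' 0| ≤ |s - s'| := abs_max_sub_max_le_abs _ _ _
  calc ‖brokenLine x v y s - brokenLine x v y s'‖ = ‖(max (-s) 0 - max (-s') 0) • x +
        ((1 - |s|) - (1 - |s'|)) • v + (max s 0 - max s' 0) • y‖ := by
        congr 1
        simp only [brokenLine]
        module
    _ ≤ |max (-s) 0 - max (-s') 0| * ‖x‖ + |(1 - |s|) - (1 - |s'|)| * ‖v‖ +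
        |max s 0 - max s' 0| * ‖y‖ := by
        simpa only [norm_smul, Real.norm_eq_abs] using norm_add₃_le
          (a := (max (-s) 0 - max (-s') 0) • x) (b := ((1 - |s|) - (1 - |s'|)) • v)
          (c := (max s 0 - max s' 0) • y)
    _ ≤ |s - s'| * 1 + |s - s'| * 2 + |s - s'| * 1 := by gcongr
    _ = 4 * |s - s'| := by ring

end brokenLine

theorem norm_lineMap_ge {E : Type*} [NormedAddCommGroup E] [InnerProductSpace ℝ E] {x e v : E}
    (hx : ‖x‖ = 1) (he : ‖e‖ = 1) (hxe : 0 ≤ inner ℝ x e) (hv : v ∈ ball e (1 / 4)) {d : ℝ}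
    (hd : 0 ≤ d) (hd1 : d ≤ 1) : 1 / 4 ≤ ‖(1 - d) • x + d • v‖ := by
  have h1 : 1 / 2 ≤ ‖(1 - d) • x + d • e‖ := by
    have h2 : ‖(1 - d) • x + d • e‖ ^ 2 = (1 - d) ^ 2 + 2 * ((1 - d) * d * inner ℝ x e) + d ^ 2 := by
      rw [norm_add_sq_real, norm_smul, norm_smul, inner_smul_left, inner_smul_right, hx, he,
        Real.norm_eq_abs, Real.norm_eq_abs, mul_one, mul_one, sq_abs, sq_abs]
      simp [mul_assoc]
    have h3 : 0 ≤ (1 - d) * d * inner ℝ x e :=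
      mul_nonneg (mul_nonneg (by linarith) hd) hxe
    refine le_of_sq_le_sq ?_ (norm_nonneg _)
    rw [h2]
    nlinarith [sq_nonneg (2 * d - 1)]
  have h4 : ‖d • (v - e)‖ ≤ 1 / 4 := by
    rw [norm_smul, Real.norm_of_nonneg hd]
    have := mem_ball_iff_norm.1 hv
    nlinarith [norm_nonneg (v - e)]
  calc (1 : ℝ) / 4 ≤ ‖(1 - d) • x + d • e‖ - ‖d • (v - e)‖ := by linarith
    _ ≤ ‖((1 - d) • x + d • e) + d • (v - e)‖ := norm_sub_le_norm_add _ _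
    _ = _ := by
      congr 1
      module

/-- Any two vectors in dimension at least two make an angle at most `π / 2` with a common
unit vector. -/
theorem exists_norm_eq_one_inner_nonneg {n : ℕ} (hn : 2 ≤ n) (x y : EuclideanSpace ℝ (Fin n)) :
    ∃ e : EuclideanSpace ℝ (Fin n), ‖e‖ = 1 ∧ 0 ≤ inner ℝ x e ∧ 0 ≤ inner ℝ y e := by
  obtain ⟨u, hu0, hu⟩ : ∃ u : EuclideanSpace ℝ (Fin n), u ≠ 0 ∧ inner ℝ (x - y) u = 0 := by
    have hlt : Module.finrank ℝ ℝ < Module.finrank ℝ (EuclideanSpace ℝ (Fin n)) := by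
      simpa using by omega
    obtain ⟨u, hu, hu0⟩ := (Submodule.ne_bot_iff _).1
      (LinearMap.ker_ne_bot_of_finrank_lt (f := (innerSL ℝ (x - y)).toLinearMap) hlt)
    exact ⟨u, hu0, hu⟩
  have hu' : 0 < ‖u‖ := norm_pos_iff.2 hu0
  have hxy : inner ℝ x u = inner ℝ y u := by rwa [inner_sub_left, sub_eq_zero] at hu
  rcases le_total 0 (inner ℝ x u) with h | h
  · refine ⟨‖u‖⁻¹ • u, norm_smul_inv_norm (𝕜 := ℝ) hu0, ?_, ?_⟩ <;> rw [inner_smul_right]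
    · positivity
    · rw [← hxy]; positivity
  · refine ⟨-(‖u‖⁻¹ • u), by rw [norm_neg]; exact norm_smul_inv_norm (𝕜 := ℝ) hu0, ?_, ?_⟩ <;>
      rw [inner_neg_right, inner_smul_right, ← mul_neg]
    · exact mul_nonneg (by positivity) (by linarith)
    · exact mul_nonneg (by positivity) (by linarith)

/-- The norm of a point on the broken line is at least `1 / 4`. -/
theorem norm_brokenLine_ge {E : Type*} [NormedAddCommGroup E] [InnerProductSpace ℝ E]
    {x y e v : E} (hx : ‖x‖ = 1) (hy : ‖y‖ = 1) (he : ‖e‖ = 1) (hxe : 0 ≤ inner ℝ x e)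
    (hye : 0 ≤ inner ℝ y e) (hv : v ∈ ball e (1 / 4)) {s : ℝ} (hs : |s| ≤ 1) :
    1 / 4 ≤ ‖brokenLine x v y s‖ := by
  have h0 : 0 ≤ 1 - |s| := by linarith
  have h1 : 1 - |s| ≤ 1 := by linarith [abs_nonneg s]
  rcases le_total s 0 with h | h
  · rw [brokenLine_of_nonpos h]
    exact norm_lineMap_ge hx he hxe hv h0 h1
  · rw [brokenLine_of_nonneg h]
    exact norm_lineMap_ge hy he hye hv h0 h1

/-- If `ρ` has arc-length integral at least one along all paths joining two given points of a
sphere of radius `t` inside that sphere, then `∫ ρ ^ n` over this sphere is at least `c / t`. -/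
theorem exists_le_lintegral_sphere {n : ℕ} (hn : 2 ≤ n) :
    ∃ c : ℝ, 0 < c ∧ ∀ (ρ : EuclideanSpace ℝ (Fin n) → ℝ≥0∞), Measurable ρ →
      ∀ (x₀ x y : EuclideanSpace ℝ (Fin n)) (t : ℝ), 0 < t → ‖x‖ = 1 → ‖y‖ = 1 →
      (∀ γ : PathOn n, γ.toFun γ.a = x₀ + t • x → γ.toFun γ.b = x₀ + t • y →
        (∀ s ∈ Icc γ.a γ.b, dist (γ.toFun s) x₀ = t) →
        1 ≤ arcIntegral n ρ γ.toFun γ.a γ.b) →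
      ENNReal.ofReal c ≤ ENNReal.ofReal (t ^ n) *
        ∫⁻ ω : sphere (0 : EuclideanSpace ℝ (Fin n)) 1,
          ρ (x₀ + t • (ω : EuclideanSpace ℝ (Fin n))) ^ n
          ∂(volume : Measure (EuclideanSpace ℝ (Fin n))).toSphere := by
  have hn0 : n ≠ 0 := by omega
  have : Nonempty (Fin n) := ⟨⟨0, by omega⟩⟩
  have hβ : (1 - 1 / n : ℝ) < 1 := by
    have : (0 : ℝ) < 1 / n := by positivity
    linarith
  set K : ℝ := (∫⁻ s in Ioo (-1 : ℝ) 1, ENNReal.ofReal ((1 - |s|) ^ (-(1 - 1 / n : ℝ)))).toReal + 1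
    with hK
  have hK0 : 0 < K := by positivity
  have hKle : ∫⁻ s in Ioo (-1 : ℝ) 1, ENNReal.ofReal ((1 - |s|) ^ (-(1 - 1 / n : ℝ))) ≤
      ENNReal.ofReal K := by
    rw [← ENNReal.ofReal_toReal (lintegral_one_sub_abs_rpow_lt_top hβ).ne]
    exact ENNReal.ofReal_le_ofReal (by linarith)
  set b : ℝ := (volume (ball (0 : EuclideanSpace ℝ (Fin n)) (1 / 4))).toReal with hb
  have hbtop : volume (ball (0 : EuclideanSpace ℝ (Fin n)) (1 / 4)) ≠ ∞ := measure_ball_lt_top.ne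
  have hb0 : 0 < b := ENNReal.toReal_pos (measure_ball_pos _ _ (by norm_num)).ne' hbtop
  have hvol : volume (ball (0 : EuclideanSpace ℝ (Fin n)) (1 / 4)) = ENNReal.ofReal b :=
    (ENNReal.ofReal_toReal hbtop).symm
  refine ⟨b / ((6 * 4 ^ (n - 1)) * (64 * K) ^ n), by positivity, ?_⟩
  intro ρ hρ x₀ x y t ht hx hy hadm
  obtain ⟨e, he, hxe, hye⟩ := exists_norm_eq_one_inner_nonneg hn x y
  set h : EuclideanSpace ℝ (Fin n) → ℝ≥0∞ := fun w => ρ (x₀ + t • (‖w‖⁻¹ • w)) with h_def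
  have hm : Measurable h := hρ.comp (by fun_prop)
  have hh : ∀ r : ℝ, 0 < r → ∀ w, h (r • w) = h w := fun r hr w => by
    simp only [h_def, norm_smul, smul_smul, Real.norm_of_nonneg hr.le]
    rw [mul_inv_rev, mul_assoc, mul_assoc, inv_mul_cancel₀ hr.ne', mul_one]
  have hsph : ∫⁻ ω : sphere (0 : EuclideanSpace ℝ (Fin n)) 1,
        ρ (x₀ + t • (ω : EuclideanSpace ℝ (Fin n))) ^ n
          ∂(volume : Measure (EuclideanSpace ℝ (Fin n))).toSphere =
      ∫⁻ ω : sphere (0 : EuclideanSpace ℝ (Fin n)) 1, h ω ^ n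
          ∂(volume : Measure (EuclideanSpace ℝ (Fin n))).toSphere := by
    simp [h_def]
  rw [hsph]
  set I := ∫⁻ ω : sphere (0 : EuclideanSpace ℝ (Fin n)) 1, h ω ^ n
          ∂(volume : Measure (EuclideanSpace ℝ (Fin n))).toSphere
  have hpath : ∀ v ∈ ball e (1 / 4),
      1 ≤ ENNReal.ofReal (32 * t) * ∫⁻ s in Ioo (-1 : ℝ) 1, h (brokenLine x v y s) := by
    intro v hv
    have hv2 : ‖v‖ ≤ 2 := by
      have := mem_ball_iff_norm.1 hv
      have := norm_sub_norm_le v e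
      linarith
    have hge : ∀ s ∈ Icc (-1 : ℝ) 1, 1 / 4 ≤ ‖brokenLine x v y s‖ := fun s hs =>
      norm_brokenLine_ge hx hy he hxe hye hv (abs_le.2 hs)
    have hne : ∀ s ∈ Icc (-1 : ℝ) 1, brokenLine x v y s ≠ 0 := fun s hs =>
      norm_pos_iff.1 (by linarith [hge s hs])
    set γ : ℝ → EuclideanSpace ℝ (Fin n) := fun s =>
      x₀ + t • (‖brokenLine x v y s‖⁻¹ • brokenLine x v y s) with hγ
    have hlip : LipschitzOnWith (Real.toNNReal (32 * t)) γ (Icc (-1) 1) := by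
      refine LipschitzOnWith.of_dist_le_mul fun s hs s' hs' => ?_
      rw [Real.coe_toNNReal _ (by positivity), hγ, dist_add_left, dist_eq_norm, ← smul_sub,
        norm_smul, Real.norm_of_nonneg ht.le, Real.dist_eq]
      have h1 := norm_inv_norm_smul_sub_le (hne s hs) (hne s' hs')
      have h2 := norm_brokenLine_sub_le hx.le hv2 hy.le s s'
      have h3 : ‖brokenLine x v y s‖⁻¹ ≤ 4 := by
        rw [inv_le_comm₀ (by linarith [hge s hs]) (by norm_num)]
        linarith [hge s hs]
      calc _ ≤ t * (2 * 4 * (4 * |s - s'|)) := by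
            gcongr
            refine h1.trans ?_
            gcongr
        _ = _ := by ring
    have hone := hadm ⟨-1, 1, by norm_num, γ, hlip.continuousOn⟩
      (by simp [hγ, brokenLine, hx]) (by simp [hγ, brokenLine, hy]) (fun s hs => by
        simp only [hγ, dist_self_add_left, norm_smul, norm_inv, norm_norm,
          Real.norm_of_nonneg ht.le]
        rw [inv_mul_cancel₀ (norm_ne_zero_iff.2 (hne s hs)), mul_one])
    refine hone.trans ((arcIntegral_le_of_lipschitzOnWith ρ (by norm_num) hlip).trans_eq ?_)
    rw [restrict_Ioo_eq_restrict_Icc]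
    rfl
  have hmq : Measurable fun p : EuclideanSpace ℝ (Fin n) × ℝ => h (brokenLine x p.1 y p.2) :=
    hm.comp (by unfold brokenLine; fun_prop)
  set κ : ℝ := 64 * t * K with hκ
  have hκ0 : 0 < κ := by positivity
  have hslice : ∀ s ∈ Ioo (-1 : ℝ) 1, ∫⁻ v in ball e (1 / 4), h (brokenLine x v y s) ≤
      (ENNReal.ofReal (κ ^ (n - 1) * (6 * 4 ^ (n - 1))) * I + ENNReal.ofReal κ⁻¹ *
        ENNReal.ofReal b) * ENNReal.ofReal ((1 - |s|) ^ (-(1 - 1 / n : ℝ))) := by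
    intro s hs
    have hd : 0 < 1 - |s| := by linarith [abs_lt.2 hs]
    have hd1 : 1 - |s| ≤ 1 := by linarith [abs_nonneg s]
    rw [← hvol]
    rcases le_total s 0 with h0 | h0
    · simp only [brokenLine_of_nonpos h0]
      exact lintegral_ball_lineMap_le_rpow hn0 hm hh hx he hd hd1 hκ0
    · simp only [brokenLine_of_nonneg h0]
      exact lintegral_ball_lineMap_le_rpow hn0 hm hh hy he hd hd1 hκ0
  have hmain : ENNReal.ofReal b ≤ ENNReal.ofReal (32 * t) *
      ((ENNReal.ofReal (κ ^ (n - 1) * (6 * 4 ^ (n - 1))) * I + ENNReal.ofReal κ⁻¹ *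
        ENNReal.ofReal b) * ENNReal.ofReal K) := by
    calc ENNReal.ofReal b = ∫⁻ v in ball e (1 / 4), 1 := by
          rw [setLIntegral_one, Measure.addHaar_ball_center, hvol]
      _ ≤ ∫⁻ v in ball e (1 / 4), ENNReal.ofReal (32 * t) *
          ∫⁻ s in Ioo (-1 : ℝ) 1, h (brokenLine x v y s) :=
          setLIntegral_mono' measurableSet_ball hpath
      _ = ENNReal.ofReal (32 * t) * ∫⁻ s in Ioo (-1 : ℝ) 1, ∫⁻ v in ball e (1 / 4),
          h (brokenLine x v y s) := by
          rw [lintegral_const_mul _ hmq.lintegral_prod_right',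
            lintegral_lintegral_swap hmq.aemeasurable]
      _ ≤ ENNReal.ofReal (32 * t) * ∫⁻ s in Ioo (-1 : ℝ) 1,
          (ENNReal.ofReal (κ ^ (n - 1) * (6 * 4 ^ (n - 1))) * I + ENNReal.ofReal κ⁻¹ *
          ENNReal.ofReal b) * ENNReal.ofReal ((1 - |s|) ^ (-(1 - 1 / n : ℝ))) := by
          gcongr 1
          exact setLIntegral_mono' measurableSet_Ioo hslice
      _ ≤ _ := by
          rw [lintegral_const_mul _ (by fun_prop)]
          gcongr
  rcases eq_or_ne I ∞ with hI | hI
  · rw [hI, ENNReal.mul_top (by simpa using pow_pos ht n)]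
    exact le_top
  lift I to ℝ≥0 using hI with i
  rw [← ENNReal.ofReal_coe_nnreal] at hmain ⊢
  have hi : (0 : ℝ) ≤ i := i.coe_nonneg
  rw [← ENNReal.ofReal_mul (by positivity), ← ENNReal.ofReal_mul (by positivity),
    ← ENNReal.ofReal_add (by positivity) (by positivity), ← ENNReal.ofReal_mul (by positivity),
    ← ENNReal.ofReal_mul (by positivity), ENNReal.ofReal_le_ofReal_iff (by positivity)] at hmain
  rw [← ENNReal.ofReal_mul (by positivity)]
  refine ENNReal.ofReal_le_ofReal ?_
  rw [div_le_iff₀ (by positivity)]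
  have hκn : κ ^ n = κ * κ ^ (n - 1) := by
    rw [← pow_succ', Nat.sub_add_cancel (by omega)]
  have hscale : t ^ n * (64 * K) ^ n = κ ^ n := by
    rw [← mul_pow, hκ]
    congr 1
    ring
  have hhalf : 32 * t * (κ⁻¹ * b * K) = b / 2 := by
    rw [hκ]
    field_simp
    norm_num
  calc b ≤ κ * κ ^ (n - 1) * (6 * 4 ^ (n - 1)) * i := by
        rw [hκ] at hhalf hmain ⊢
        linarith
    _ = (6 * 4 ^ (n - 1)) * i * κ ^ n := by rw [hκn]; ring
    _ = _ := by rw [← hscale]; ring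

theorem IsConnected.exists_dist_eq {X : Type*} [PseudoMetricSpace X] {E : Set X}
    (hE : IsConnected E) {x₀ p q : X} (hp : p ∈ E) (hq : q ∈ E) {t : ℝ} (h1 : dist p x₀ ≤ t)
    (h2 : t ≤ dist q x₀) : ∃ z ∈ E, dist z x₀ = t :=
  hE.isPreconnected.intermediate_value hp hq
    (continuous_id.dist continuous_const).continuousOn ⟨h1, h2⟩

theorem lintegral_Ioo_ofReal_inv {r R : ℝ} (hr : 0 < r) (hrR : r ≤ R) :
    ∫⁻ t in Ioo r R, ENNReal.ofReal t⁻¹ = ENNReal.ofReal (Real.log (R / r)) := by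
  rw [← integral_inv_of_pos hr (hr.trans_le hrR), intervalIntegral.integral_of_le hrR,
    Measure.restrict_congr_set Ioo_ae_eq_Ioc, ofReal_integral_eq_lintegral_ofReal]
  · rw [← IntegrableOn, ← intervalIntegrable_iff_integrableOn_Ioc_of_le hrR]
    refine intervalIntegral.intervalIntegrable_inv (fun t ht => ?_) continuousOn_id
    rw [uIcc_of_le hrR] at ht
    exact (hr.trans_le ht.1).ne'
  · filter_upwards [ae_restrict_mem measurableSet_Ioc] with t ht
    exact inv_nonneg.2 (hr.trans ht.1).le

/-- Two sets meeting all the spheres of radius in `(r, R)` inside a ball contained in `D` are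
joined in `D` by a path family of modulus at least `c log (R / r)`. -/
theorem exists_mul_log_le_modulus {n : ℕ} (hn : 2 ≤ n) :
    ∃ c : ℝ, 0 < c ∧ ∀ (D E F : Set (EuclideanSpace ℝ (Fin n))) (x₀ : EuclideanSpace ℝ (Fin n))
      (r R : ℝ), 0 < r → r ≤ R → ball x₀ R ⊆ D →
      (∀ t ∈ Ioo r R, ∃ z ∈ E, dist z x₀ = t) → (∀ t ∈ Ioo r R, ∃ z ∈ F, dist z x₀ = t) →
      ENNReal.ofReal (c * Real.log (R / r)) ≤ modulus n (pathsBetween n E F D) := by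
  obtain ⟨c, hc, hsphere⟩ := exists_le_lintegral_sphere hn
  refine ⟨c, hc, fun D E F x₀ r R hr hrR hD hE hF => le_iInf₂ fun ρ hρ => ?_⟩
  have : Nonempty (Fin n) := ⟨⟨0, by omega⟩⟩
  have hslice : ∀ t ∈ Ioo r R, ENNReal.ofReal c * ENNReal.ofReal t⁻¹ ≤
      ENNReal.ofReal (t ^ (n - 1)) * ∫⁻ ω : sphere (0 : EuclideanSpace ℝ (Fin n)) 1,
        ρ (x₀ + t • (ω : EuclideanSpace ℝ (Fin n))) ^ n
        ∂(volume : Measure (EuclideanSpace ℝ (Fin n))).toSphere := by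
    intro t ht
    have ht0 : 0 < t := hr.trans ht.1
    have hunit : ∀ z : EuclideanSpace ℝ (Fin n), dist z x₀ = t →
        ‖t⁻¹ • (z - x₀)‖ = 1 ∧ x₀ + t • (t⁻¹ • (z - x₀)) = z := fun z hz => by
      constructor
      · rw [norm_smul, ← dist_eq_norm, hz, Real.norm_of_nonneg (by positivity),
          inv_mul_cancel₀ ht0.ne']
      · rw [smul_inv_smul₀ ht0.ne', add_sub_cancel]
    obtain ⟨p, hpE, hp⟩ := hE t ht
    obtain ⟨q, hqF, hq⟩ := hF t ht
    have hle := hsphere ρ hρ.1 x₀ _ _ t ht0 (hunit p hp).1 (hunit q hq).1 fun γ ha hb hγ => by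
      rw [(hunit p hp).2] at ha
      rw [(hunit q hq).2] at hb
      refine hρ.2 γ ⟨ha ▸ hpE, hb ▸ hqF, fun s hs => hD ?_⟩
      rw [mem_ball, hγ s (Ioo_subset_Icc_self hs)]
      exact ht.2
    calc ENNReal.ofReal c * ENNReal.ofReal t⁻¹ ≤ _ := mul_le_mul_left hle _
      _ = _ := by
        rw [mul_right_comm, ← ENNReal.ofReal_mul (by positivity)]
        congr 2
        obtain ⟨m, rfl⟩ := Nat.exists_eq_succ_of_ne_zero (show n ≠ 0 by omega)
        rw [Nat.succ_eq_add_one, Nat.add_sub_cancel, pow_succ, mul_assoc, mul_inv_cancel₀ ht0.ne',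
          mul_one]
  calc ENNReal.ofReal (c * Real.log (R / r))
      = ∫⁻ t in Ioo r R, ENNReal.ofReal c * ENNReal.ofReal t⁻¹ := by
        rw [lintegral_const_mul _ (by fun_prop), lintegral_Ioo_ofReal_inv hr hrR,
          ENNReal.ofReal_mul hc.le]
    _ ≤ ∫⁻ t in Ioo r R, ENNReal.ofReal (t ^ (n - 1)) *
        ∫⁻ ω : sphere (0 : EuclideanSpace ℝ (Fin n)) 1,
          ρ (x₀ + t • (ω : EuclideanSpace ℝ (Fin n))) ^ n
          ∂(volume : Measure (EuclideanSpace ℝ (Fin n))).toSphere :=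
        setLIntegral_mono' measurableSet_Ioo hslice
    _ ≤ ∫⁻ t in Ioi (0 : ℝ), ENNReal.ofReal (t ^ (n - 1)) *
        ∫⁻ ω : sphere (0 : EuclideanSpace ℝ (Fin n)) 1,
          ρ (x₀ + t • (ω : EuclideanSpace ℝ (Fin n))) ^ n
          ∂(volume : Measure (EuclideanSpace ℝ (Fin n))).toSphere :=
        lintegral_mono_set fun t ht => hr.trans ht.1
    _ = ∫⁻ x, ρ (x₀ + x) ^ n := by
        rw [lintegral_polar volume (f := fun x => ρ (x₀ + x) ^ n)
          ((hρ.1.comp (measurable_const_add x₀)).pow_const n), finrank_euclideanSpace_fin]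
    _ = ∫⁻ x, ρ x ^ n := lintegral_add_left_eq_self (fun x => ρ x ^ n) x₀

theorem le_dist_of_mem_frontier {X : Type*} [PseudoMetricSpace X] {U : Set X} {x₀ z : X} {R : ℝ}
    (hU : ball x₀ R ⊆ U) (hz : z ∈ frontier U) : R ≤ dist z x₀ := by
  by_contra! h
  exact hz.2 (interior_maximal hU isOpen_ball h)

/-- **Lemma 2 (Väisälä's lemma on weak flatness of inner points).** -/
theorem weak_flatness_of_inner_points
    (n : ℕ) (hn : 2 ≤ n)
    (D : Set (EuclideanSpace ℝ (Fin n))) (hD : IsOpen D) (hDconn : IsConnected D)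
    (x₀ : EuclideanSpace ℝ (Fin n)) (hx₀ : x₀ ∈ D)
    (P : ℝ) (hP : 0 < P)
    (U : Set (EuclideanSpace ℝ (Fin n))) (hU : U ∈ nhds x₀) :
    ∃ V ∈ nhds x₀, V ⊆ U ∧
      ∀ E F : Set (EuclideanSpace ℝ (Fin n)),
        IsCompact E → IsConnected E → E ⊆ D →
        IsCompact F → IsConnected F → F ⊆ D →
        (E ∩ frontier U).Nonempty → (E ∩ frontier V).Nonempty →
        (F ∩ frontier U).Nonempty → (F ∩ frontier V).Nonempty →
        ENNReal.ofReal P < modulus n (pathsBetween n E F D) := by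
  obtain ⟨c, hc, hmod⟩ := exists_mul_log_le_modulus hn
  obtain ⟨R, hR, hball⟩ := Metric.mem_nhds_iff.1 (Filter.inter_mem hU (hD.mem_nhds hx₀))
  set M : ℝ := P / c + 1 with hM
  have hM0 : 0 < M := by positivity
  set r : ℝ := R * Real.exp (-M) with hr
  have hr0 : 0 < r := by positivity
  have hrR : r ≤ R := mul_le_of_le_one_right hR.le (Real.exp_le_one_iff.2 (by linarith))
  refine ⟨ball x₀ r, ball_mem_nhds _ hr0,
    (ball_subset_ball hrR).trans (hball.trans inter_subset_left), ?_⟩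
  have hmeet : ∀ E : Set (EuclideanSpace ℝ (Fin n)), IsConnected E → (E ∩ frontier U).Nonempty →
      (E ∩ frontier (ball x₀ r)).Nonempty → ∀ t ∈ Ioo r R, ∃ z ∈ E, dist z x₀ = t := by
    rintro E hE ⟨q, hqE, hq⟩ ⟨p, hpE, hp⟩ t ht
    refine hE.exists_dist_eq hpE hqE ?_ (ht.2.le.trans ?_)
    · exact (mem_sphere.1 (frontier_ball_subset_sphere hp)).le.trans ht.1.le
    · exact le_dist_of_mem_frontier (hball.trans inter_subset_left) hq
  intro E F _ hE _ _ hF _ hEU hEV hFU hFV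
  refine lt_of_lt_of_le ?_ (hmod D E F x₀ r R hr0 hrR (hball.trans inter_subset_right)
    (hmeet E hE hEU hEV) (hmeet F hF hFU hFV))
  have hlog : R / r = Real.exp M := by
    rw [hr, Real.exp_neg]
    field_simp
  rw [hlog, Real.log_exp, ENNReal.ofReal_lt_ofReal_iff (by positivity), hM, mul_add,
    mul_div_cancel₀ _ hc.ne']
  linarith

end
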